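/- Let cˡ, cʰ, cᶠ be reals with 0 ≤ cˡ < cʰ < cᶠ and K₁ˡ > 0. Set α := K₁ˡ/(cʰ − cˡ), c₃(c₁) := (c₁/2)·(1 + α/(α − c₁)), and c₄(c₁) := ((cʰ − cˡ)²/2)·(α − c₁). Then the two functions c₁ ↦ c₃(c₁)·(cᶠ − cʰ) − c₄(c₁)/(cᶠ − cʰ) and c₁ ↦ c₃(c₁)·(cᶠ − cʰ) + c₄(c₁)/(cᶠ − cʰ) are continuous and strictly increasing on the interval [K₁ˡ/(cᶠ − cˡ), α), and each tends to +∞ as c₁ → α from the left. -/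

import Mathlib

open Set Filter Topology in
/-- If `α / (α - b) ≥ r` and `2 * s < D * (1 + r ^ 2)`, the function
`c ↦ c / 2 * (1 + α / (α - c)) * D + s * (α - c)` is continuous and strictly increasing on
`[b, α)` and tends to `+∞` at the right endpoint. -/
theorem continuousOn_strictMonoOn_tendsto_boundarySupply {α D b r s : ℝ}
    (hα : 0 < α) (hD : 0 < D) (hr : 0 ≤ r) (hb : r * (α - b) ≤ α)
    (hs : 2 * s < D * (1 + r ^ 2)) :
    ContinuousOn (fun c : ℝ => c / 2 * (1 + α / (α - c)) * D + s * (α - c)) (Ico b α) ∧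
    StrictMonoOn (fun c : ℝ => c / 2 * (1 + α / (α - c)) * D + s * (α - c)) (Ico b α) ∧
    Tendsto (fun c : ℝ => c / 2 * (1 + α / (α - c)) * D + s * (α - c)) (𝓝[<] α) atTop := by
  refine ⟨?_, ?_, ?_⟩
  · have hne : ∀ c ∈ Ico b α, α - c ≠ 0 := fun c hc => (sub_pos.2 hc.2).ne'
    fun_prop (disch := assumption)
  · intro x hx y hy hxy
    have hx0 : 0 < α - x := sub_pos.2 hx.2
    have hy0 : 0 < α - y := sub_pos.2 hy.2
    have hrx : r * (α - x) ≤ α :=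
      (mul_le_mul_of_nonneg_left (by linarith [hx.1]) hr).trans hb
    have hry : r * (α - y) ≤ α :=
      (mul_le_mul_of_nonneg_left (by linarith [hy.1]) hr).trans hb
    have hq : r ^ 2 ≤ α ^ 2 / ((α - x) * (α - y)) := by
      rw [le_div_iff₀ (mul_pos hx0 hy0)]
      calc r ^ 2 * ((α - x) * (α - y)) = (r * (α - x)) * (r * (α - y)) := by ring
        _ ≤ α * α := mul_le_mul hrx hry (by positivity) hα.le
        _ = α ^ 2 := by ring
    have hdiff : (y / 2 * (1 + α / (α - y)) * D + s * (α - y))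
        - (x / 2 * (1 + α / (α - x)) * D + s * (α - x))
        = (y - x) / 2 * (D * (1 + α ^ 2 / ((α - x) * (α - y))) - 2 * s) := by
      field_simp
      ring
    have hpos : 0 < D * (1 + α ^ 2 / ((α - x) * (α - y))) - 2 * s := by
      have := mul_le_mul_of_nonneg_left hq hD.le
      linarith
    have := mul_pos (half_pos (sub_pos.2 hxy)) hpos
    exact sub_pos.1 (hdiff ▸ this)
  · have hsub : Tendsto (fun c : ℝ => α - c) (𝓝[<] α) (𝓝[>] 0) := by
      refine tendsto_nhdsWithin_iff.2 ⟨?_, ?_⟩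
      · have : Tendsto (fun c : ℝ => α - c) (𝓝 α) (𝓝 (α - α)) :=
          Continuous.tendsto (by fun_prop) α
        rw [sub_self] at this
        exact this.mono_left nhdsWithin_le_nhds
      · filter_upwards [self_mem_nhdsWithin] with c hc using sub_pos.2 (mem_Iio.1 hc)
    have hinv : Tendsto (fun c : ℝ => 1 + α / (α - c)) (𝓝[<] α) atTop := by
      refine tendsto_atTop_add_const_left _ _ ?_
      simpa only [div_eq_mul_inv, Function.comp_apply] using
        (tendsto_inv_nhdsGT_zero.comp hsub).const_mul_atTop hα
    have hhalf : Tendsto (fun c : ℝ => c / 2) (𝓝[<] α) (𝓝 (α / 2)) :=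
      (Continuous.tendsto (by fun_prop) α).mono_left nhdsWithin_le_nhds
    have hlin : Tendsto (fun c : ℝ => s * (α - c)) (𝓝[<] α) (𝓝 (s * (α - α))) :=
      (Continuous.tendsto (f := fun c : ℝ => s * (α - c)) (by fun_prop) α).mono_left
        nhdsWithin_le_nhds
    exact ((hhalf.pos_mul_atTop (half_pos hα) hinv).atTop_mul_const hD).atTop_add hlin

/-- The two boundary-supply expressions
`c₁ ↦ c₃(c₁)(cᶠ−cʰ) ∓ c₄(c₁)/(cᶠ−cʰ)` are continuous and strictly increasing on
`[K₁ˡ/(cᶠ−cˡ), α)` and tend to `+∞` as `c₁ → α⁻`. -/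
theorem stmt_3 (cl ch cf K1l : ℝ)
    (hcl : 0 ≤ cl) (hlh : cl < ch) (hhf : ch < cf) (hK : 0 < K1l) :
    let α := K1l / (ch - cl)
    let f := fun c₁ : ℝ => (c₁ / 2) * (1 + α / (α - c₁)) * (cf - ch)
        - ((ch - cl) ^ 2 / 2) * (α - c₁) / (cf - ch)
    let g := fun c₁ : ℝ => (c₁ / 2) * (1 + α / (α - c₁)) * (cf - ch)
        + ((ch - cl) ^ 2 / 2) * (α - c₁) / (cf - ch)
    (ContinuousOn f (Set.Ico (K1l / (cf - cl)) α) ∧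
     StrictMonoOn f (Set.Ico (K1l / (cf - cl)) α) ∧
     Filter.Tendsto f (nhdsWithin α (Set.Iio α)) Filter.atTop) ∧
    (ContinuousOn g (Set.Ico (K1l / (cf - cl)) α) ∧
     StrictMonoOn g (Set.Ico (K1l / (cf - cl)) α) ∧
     Filter.Tendsto g (nhdsWithin α (Set.Iio α)) Filter.atTop) := by
  intro α f g
  have hd : 0 < ch - cl := sub_pos.2 hlh
  have hD : 0 < cf - ch := sub_pos.2 hhf
  have hE : 0 < cf - cl := by linarith
  have hα : 0 < α := div_pos hK hd
  have hr : 0 ≤ (cf - cl) / (cf - ch) := (div_pos hE hD).le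
  have hb : (cf - cl) / (cf - ch) * (α - K1l / (cf - cl)) ≤ α := by
    refine le_of_eq ?_
    simp only [α]
    field_simp
    ring
  have hs : 2 * ((ch - cl) ^ 2 / 2 / (cf - ch))
      < (cf - ch) * (1 + ((cf - cl) / (cf - ch)) ^ 2) := by
    have h : (cf - ch) * (1 + ((cf - cl) / (cf - ch)) ^ 2)
        - 2 * ((ch - cl) ^ 2 / 2 / (cf - ch)) = 2 * (cf - cl) := by
      field_simp
      ring
    linarith
  have hs' : 2 * -((ch - cl) ^ 2 / 2 / (cf - ch))
      < (cf - ch) * (1 + ((cf - cl) / (cf - ch)) ^ 2) := by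
    have : 0 < (ch - cl) ^ 2 / 2 / (cf - ch) := by positivity
    linarith
  have hf : f = fun c => c / 2 * (1 + α / (α - c)) * (cf - ch)
      + -((ch - cl) ^ 2 / 2 / (cf - ch)) * (α - c) := by
    funext c
    simp only [f]
    ring
  have hg : g = fun c => c / 2 * (1 + α / (α - c)) * (cf - ch)
      + (ch - cl) ^ 2 / 2 / (cf - ch) * (α - c) := by
    funext c
    simp only [g]
    ring
  rw [hf, hg]
  exact ⟨continuousOn_strictMonoOn_tendsto_boundarySupply hα hD hr hb hs',
    continuousOn_strictMonoOn_tendsto_boundarySupply hα hD hr hb hs⟩
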